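/- Let α ∈ (0, 1) and s > 0. Let u be uniform on (0, π) and w be exponential with rate 1, independent (i.e., work under the product measure Unif(0,π) ⊗ Exp(1)). Then the probability of the event { (sin(α u) / (sin(u)·cos(α π/2))^{1/α}) · (sin((1−α)u)/w)^{(1−α)/α} ≤ s } equals (1/π) ∫₀^π exp(−q̃_α(u)·s^{−α/(1−α)}) du, where q̃_α(u) = (sin(α u))^{α/(1−α)} · sin((1−α)u) / (sin(u)·cos(α π/2))^{1/(1−α)}. -/

import Mathlib

open MeasureTheory ProbabilityTheory Real

/-- The uniform distribution on the interval `(0, π)`. -/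
noncomputable def unifMeasure : Measure ℝ :=
  (ENNReal.ofReal Real.pi)⁻¹ • (volume.restrict (Set.Ioo (0:ℝ) Real.pi))

/-- `q̃_α(u) = (sin(α u))^{α/(1−α)} · sin((1−α)u) / (sin(u)·cos(α π/2))^{1/(1−α)}`. -/
noncomputable def qTilde (α u : ℝ) : ℝ :=
  Real.sin (α * u) ^ (α / (1 - α)) * Real.sin ((1 - α) * u) /
    (Real.sin u * Real.cos (α * Real.pi / 2)) ^ (1 / (1 - α))

lemma aux_alg (α a b c w s : ℝ) (h0 : 0 < α) (h1 : α < 1) (ha : 0 < a) (hb : 0 < b)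
    (hc : 0 < c) (hw : 0 < w) (hs : 0 < s) :
    a / b ^ (1 / α) * (c / w) ^ ((1 - α) / α) ≤ s ↔
      a ^ (α / (1 - α)) * c / b ^ (1 / (1 - α)) * s ^ (-(α / (1 - α))) ≤ w := by
  have h2 : 0 < 1 - α := by linarith
  have hγ : 0 < α / (1 - α) := by positivity
  have hX : (a / b ^ (1 / α) * (c / w) ^ ((1 - α) / α)) ^ (α / (1 - α))
      = a ^ (α / (1 - α)) / b ^ (1 / (1 - α)) * (c / w) := by
    rw [Real.mul_rpow (by positivity) (by positivity), Real.div_rpow ha.le (by positivity),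
      ← Real.rpow_mul hb.le, ← Real.rpow_mul (by positivity)]
    have e1 : 1 / α * (α / (1 - α)) = 1 / (1 - α) := by field_simp
    have e2 : (1 - α) / α * (α / (1 - α)) = 1 := by field_simp
    rw [e1, e2, Real.rpow_one]
  rw [← Real.rpow_le_rpow_iff (by positivity) hs.le hγ, hX, Real.rpow_neg hs.le]
  have hS : 0 < s ^ (α / (1 - α)) := by positivity
  have hB : 0 < b ^ (1 / (1 - α)) := by positivity
  generalize s ^ (α / (1 - α)) = S at *
  generalize b ^ (1 / (1 - α)) = B at *
  generalize a ^ (α / (1 - α)) = A at *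
  rw [show A / B * (c / w) = (A * c / B) / w by field_simp, div_le_iff₀ hw,
    ← div_eq_mul_inv, div_le_iff₀ hS, mul_comm S w]

lemma aux_exp (t : ℝ) (ht : 0 ≤ t) :
    (expMeasure 1) (Set.Iic t) = ENNReal.ofReal (1 - Real.exp (-t)) := by
  have := isProbabilityMeasure_expMeasure (r := 1) one_pos
  rw [← ProbabilityTheory.ofReal_cdf, cdf_expMeasure_eq one_pos, if_pos ht, one_mul]

lemma aux_slice (S : Set ℝ) (t : ℝ) (ht : 0 ≤ t) (h : ∀ w, 0 < w → (w ∈ S ↔ t ≤ w)) :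
    (expMeasure 1) S = ENNReal.ofReal (Real.exp (-t)) := by
  have := isProbabilityMeasure_expMeasure (r := 1) one_pos
  have h0 : ∀ᵐ w ∂(expMeasure 1), 0 < w := by
    rw [ae_iff]
    have := aux_exp 0 le_rfl
    simp only [neg_zero, Real.exp_zero, sub_self, ENNReal.ofReal_zero] at this
    convert this using 2
    ext w; simp
  have hac : expMeasure 1 ≪ (volume : Measure ℝ) := withDensity_absolutelyContinuous _ _
  have h1 : ∀ᵐ w ∂(expMeasure 1), w ≠ t := by
    apply hac.ae_le
    exact Measure.ae_ne volume t
  have hae : S =ᵐ[expMeasure 1] (Set.Iic t)ᶜ := by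
    filter_upwards [h0, h1] with w hw hne
    apply propext
    change w ∈ S ↔ w ∈ (Set.Iic t)ᶜ
    rw [h w hw]
    simp only [Set.mem_compl_iff, Set.mem_Iic, not_le]
    exact ⟨fun h => lt_of_le_of_ne h hne.symm, le_of_lt⟩
  have hm : (expMeasure 1) S = (expMeasure 1) ((Set.Iic t)ᶜ : Set ℝ) := measure_congr hae
  rw [hm, prob_compl_eq_one_sub measurableSet_Iic, aux_exp t ht,
    ← ENNReal.ofReal_one, ← ENNReal.ofReal_sub _ (by
      have : Real.exp (-t) ≤ 1 := Real.exp_le_one_iff.2 (by linarith)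
      linarith)]
  congr 1; ring

lemma aux_pos (α u : ℝ) (hα : α ∈ Set.Ioo (0:ℝ) 1) (hu : u ∈ Set.Ioo (0:ℝ) Real.pi) :
    0 < Real.sin (α * u) ∧ 0 < Real.sin u * Real.cos (α * Real.pi / 2) ∧
      0 < Real.sin ((1 - α) * u) := by
  obtain ⟨h0, h1⟩ := hα
  obtain ⟨u0, u1⟩ := hu
  have hp := Real.pi_pos
  refine ⟨Real.sin_pos_of_pos_of_lt_pi (by positivity) (by nlinarith),
    mul_pos (Real.sin_pos_of_pos_of_lt_pi u0 u1) (Real.cos_pos_of_mem_Ioo ⟨?_, ?_⟩),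
    Real.sin_pos_of_pos_of_lt_pi (mul_pos (by linarith) u0) (by nlinarith)⟩
  · have : 0 < α * Real.pi := by positivity
    linarith
  · nlinarith

/-- Let `α ∈ (0, 1)` and `s > 0`. For `u` uniform on `(0,π)` and `w ∼ Exp(1)` independent
(product measure `Unif(0,π) ⊗ Exp(1)`), the probability of the event
`{ (sin(α u)/(sin(u)·cos(α π/2))^{1/α}) · (sin((1−α)u)/w)^{(1−α)/α} ≤ s }`
equals `(1/π) ∫₀^π exp(−q̃_α(u)·s^{−α/(1−α)}) du`. -/
theorem stmt_19 (α s : ℝ) (hα : α ∈ Set.Ioo (0:ℝ) 1) (hs : 0 < s) :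
    (unifMeasure.prod (expMeasure 1))
        {p : ℝ × ℝ |
          Real.sin (α * p.1) / (Real.sin p.1 * Real.cos (α * Real.pi / 2)) ^ (1 / α) *
              (Real.sin ((1 - α) * p.1) / p.2) ^ ((1 - α) / α) ≤ s}
      = ENNReal.ofReal
          ((1 / Real.pi) *
            ∫ u in (0:ℝ)..Real.pi, Real.exp (-qTilde α u * s ^ (-(α / (1 - α))))) := by
  have := isProbabilityMeasure_expMeasure (r := 1) one_pos
  have hp := Real.pi_pos
  have hq : ∀ u ∈ Set.Ioo (0:ℝ) Real.pi, 0 ≤ qTilde α u * s ^ (-(α / (1 - α))) := by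
    intro u hu
    obtain ⟨ha, hb, hc⟩ := aux_pos α u hα hu
    unfold qTilde
    positivity
  have hmq : Measurable fun u => Real.exp (-qTilde α u * s ^ (-(α / (1 - α)))) := by
    unfold qTilde
    fun_prop
  rw [Measure.prod_apply (measurableSet_le (by fun_prop) (by fun_prop))]
  unfold unifMeasure
  rw [lintegral_smul_measure, ENNReal.ofReal_mul (by positivity), one_div Real.pi,
    ENNReal.ofReal_inv_of_pos hp, smul_eq_mul, intervalIntegral.integral_of_le hp.le,
    integral_Ioc_eq_integral_Ioo, ofReal_integral_eq_lintegral_ofReal]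
  · congr 1
    apply setLIntegral_congr_fun measurableSet_Ioo
    intro u hu
    obtain ⟨ha, hb, hc⟩ := aux_pos α u hα hu
    simp only [neg_mul]
    apply aux_slice _ _ (hq u hu)
    intro w hw
    exact aux_alg α _ _ _ w s hα.1 hα.2 ha hb hc hw hs
  · refine Measure.integrableOn_of_bounded (M := 1) (by simp) hmq.aestronglyMeasurable ?_
    filter_upwards [ae_restrict_mem measurableSet_Ioo] with u hu
    rw [Real.norm_eq_abs, Real.abs_exp, Real.exp_le_one_iff, neg_mul]
    linarith [hq u hu]
  · exact Filter.Eventually.of_forall fun u => (Real.exp_pos _).le
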